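/- For all integers n ≥ 0 and b ≥ 0, the number of noncrossing partitions of {0,1,…,n} with exactly b + 1 blocks equals the number of pairs (A, μ) where A is a subset of {1,…,n} and μ is a noncrossing partial matching of A (with A linearly ordered as a subset of the integers) having exactly b blocks; for A = ∅, μ is the empty matching with 0 blocks. -/

import Mathlib

open Finset Polynomial

/-- `(i,j)` with `i < j` is an arc of the arc diagram of `P`: `i` and `j` lie in a common
block `B` and no element of `B` is strictly between them. -/
def IsArc {s : Finset ℕ} (P : Finpartition s) (i j : ℕ) : Prop :=
  i < j ∧ ∃ B ∈ P.parts, i ∈ B ∧ j ∈ B ∧ ∀ l ∈ B, ¬(i < l ∧ l < j)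

/-- `(i,j)` is an arc or a loop (`i = j` and `{i}` a singleton block) of the arc diagram. -/
def IsDiagArc {s : Finset ℕ} (P : Finpartition s) (i j : ℕ) : Prop :=
  IsArc P i j ∨ (i = j ∧ {i} ∈ P.parts)

/-- `P` has a `k`-crossing: arcs `(i₁,j₁),…,(i_k,j_k)` with `i₁<⋯<i_k<j₁<⋯<j_k`. -/
def HasKCrossing {s : Finset ℕ} (P : Finpartition s) (k : ℕ) : Prop :=
  ∃ f g : Fin k → ℕ,
    StrictMono f ∧ StrictMono g ∧ (∀ m, IsDiagArc P (f m) (g m)) ∧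
    ∀ a b : Fin k, f a < g b

/-- `P` has a weak `k`-crossing: arcs `(i₁,j₁),…,(i_k,j_k)` with
`i₁<⋯<i_k = j₁<⋯<j_k` (the largest left endpoint equals the smallest right endpoint). -/
def HasWeakKCrossing {s : Finset ℕ} (P : Finpartition s) (k : ℕ) : Prop :=
  ∃ f g : Fin k → ℕ,
    StrictMono f ∧ StrictMono g ∧ (∀ m, IsDiagArc P (f m) (g m)) ∧
    ∃ a b : Fin k, f a = g b ∧ (∀ c, f c ≤ f a) ∧ (∀ c, g b ≤ g c)

/-- `P` has an enhanced `k`-crossing: a `k`-crossing or a weak `k`-crossing. -/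
def HasEnhancedKCrossing {s : Finset ℕ} (P : Finpartition s) (k : ℕ) : Prop :=
  HasKCrossing P k ∨ HasWeakKCrossing P k

open scoped Classical in
/-- The generating polynomial `∑ t^{number of blocks}` over the partitions of `s`
satisfying the predicate `pr`. -/
noncomputable def partPoly (s : Finset ℕ) (pr : Finpartition s → Prop) : Polynomial ℤ :=
  ∑ P : Finpartition s, if pr P then (X : Polynomial ℤ) ^ P.parts.card else 0


/-- A partial matching: every block has size one or two. -/
def IsPartialMatching {s : Finset ℕ} (P : Finpartition s) : Prop :=
  ∀ B ∈ P.parts, B.card = 1 ∨ B.card = 2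

section Arcs

variable {s : Finset ℕ} {P Q : Finpartition s} {i j k : ℕ}

theorem isArc_iff_mem_part :
    IsArc P i j ↔ i < j ∧ i ∈ P.part j ∧ ∀ l ∈ P.part j, ¬(i < l ∧ l < j) := by
  refine and_congr_right fun _ => ⟨?_, fun ⟨hi, hl⟩ => ?_⟩
  · rintro ⟨B, hB, hi, hj, hl⟩
    rw [P.part_eq_of_mem hB hj]
    exact ⟨hi, hl⟩
  · have hj : j ∈ s := P.part_nonempty.1 ⟨i, hi⟩
    exact ⟨P.part j, P.part_mem.2 hj, hi, P.mem_part hj, hl⟩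

theorem IsArc.mem_left (h : IsArc P i j) : i ∈ s := by
  obtain ⟨_, B, hB, hi, -⟩ := h
  exact P.le hB hi

theorem IsArc.mem_right (h : IsArc P i j) : j ∈ s := by
  obtain ⟨_, B, hB, -, hj, -⟩ := h
  exact P.le hB hj

theorem IsArc.left_unique {i' : ℕ} (h : IsArc P i j) (h' : IsArc P i' j) : i = i' := by
  rw [isArc_iff_mem_part] at h h'
  have h₁ := h.2.2 i' h'.2.1
  have h₂ := h'.2.2 i h.2.1
  grind

theorem IsArc.right_unique {j' : ℕ} (h : IsArc P i j) (h' : IsArc P i j') : j = j' := by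
  obtain ⟨hij, B, hB, hi, hj, hl⟩ := h
  obtain ⟨hij', B', hB', hi', hj', hl'⟩ := h'
  obtain rfl : B = B' := by
    rw [← P.part_eq_of_mem hB hi, P.part_eq_of_mem hB' hi']
  have h₁ := hl j' hj'
  have h₂ := hl' j hj
  grind

theorem exists_isArc_of_mem_part (hk : k ∈ P.part j) (hkj : k < j) :
    ∃ i, k ≤ i ∧ IsArc P i j := by
  have hne : ((P.part j).filter (· < j)).Nonempty := ⟨k, by simp [hk, hkj]⟩
  refine ⟨_, le_max' ((P.part j).filter (· < j)) k (mem_filter.2 ⟨hk, hkj⟩), isArc_iff_mem_part.2 ?_⟩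
  have hm := max'_mem _ hne
  rw [mem_filter] at hm
  refine ⟨hm.2, hm.1, fun l hl ⟨h₁, h₂⟩ => h₁.not_ge ?_⟩
  exact le_max' _ l (mem_filter.2 ⟨hl, h₂⟩)

theorem mem_part_of_isArc_imp (h : ∀ i j, IsArc P i j → IsArc Q i j) :
    ∀ j k, k < j → k ∈ P.part j → k ∈ Q.part j := by
  intro j
  induction j using Nat.strong_induction_on with
  | _ j ih =>
    intro k hkj hk
    obtain ⟨i, hki, hij⟩ := exists_isArc_of_mem_part hk hkj
    have hQ := (isArc_iff_mem_part.1 (h i j hij)).2.1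
    obtain rfl | hlt := hki.eq_or_lt
    · exact hQ
    · have hP := (isArc_iff_mem_part.1 hij).2.1
      have hi := hij.mem_left
      have hj := hij.mem_right
      rw [P.mem_part_iff_part_eq_part hi hj] at hP
      rw [Q.mem_part_iff_part_eq_part hi hj] at hQ
      rw [← hQ]
      exact ih i hij.1 k hlt (hP ▸ hk)

theorem part_subset_of_isArc_imp (h : ∀ i j, IsArc P i j → IsArc Q i j) (j : ℕ) :
    P.part j ⊆ Q.part j := by
  intro k hk
  have hks : k ∈ s := P.part_subset j hk
  have hjs : j ∈ s := P.part_nonempty.1 ⟨k, hk⟩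
  rcases lt_trichotomy k j with hlt | rfl | hlt
  · exact mem_part_of_isArc_imp h j k hlt hk
  · exact Q.mem_part hks
  · rw [Q.mem_part_iff_part_eq_part hks hjs, eq_comm, ← Q.mem_part_iff_part_eq_part hjs hks]
    refine mem_part_of_isArc_imp h k j hlt ?_
    rwa [P.mem_part_iff_part_eq_part hjs hks, eq_comm, ← P.mem_part_iff_part_eq_part hks hjs]

/-- A partition is determined by its arcs. -/
theorem finpartition_ext_isArc (h : ∀ i j, IsArc P i j ↔ IsArc Q i j) : P = Q := by
  have hpart : ∀ j, P.part j = Q.part j := fun j =>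
    (part_subset_of_isArc_imp (fun i j => (h i j).1) j).antisymm
      (part_subset_of_isArc_imp (fun i j => (h i j).2) j)
  have himage : ∀ R : Finpartition s, R.parts = s.image R.part := by
    intro R
    ext B
    refine ⟨fun hB => ?_, fun hB => ?_⟩
    · obtain ⟨x, hx⟩ := R.nonempty_of_mem_parts hB
      exact mem_image.2 ⟨x, R.le hB hx, R.part_eq_of_mem hB hx⟩
    · obtain ⟨x, hx, rfl⟩ := mem_image.1 hB
      exact R.part_mem.2 hx
  ext1
  rw [himage P, himage Q, funext hpart]

open scoped Classical in
/-- Blocks correspond to their minima, which are the elements that end no arc. -/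
theorem card_parts_add_card_filter_isArc (P : Finpartition s) :
    P.parts.card + (s.filter fun j => ∃ i, IsArc P i j).card = s.card := by
  have hparts : (s.filter fun j => ¬∃ i, IsArc P i j).card = P.parts.card := by
    refine card_nbij P.part (fun j hj => ?_) (fun j hj k hk hjk => ?_) (fun B hB => ?_)
    · exact P.part_mem.2 (mem_filter.1 hj).1
    · simp only [coe_filter, Set.mem_ofPred_eq] at hj hk
      rcases lt_trichotomy j k with hlt | rfl | hlt
      · obtain ⟨i, -, hi⟩ := exists_isArc_of_mem_part (hjk ▸ P.mem_part hj.1) hlt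
        exact absurd ⟨i, hi⟩ hk.2
      · rfl
      · obtain ⟨i, -, hi⟩ := exists_isArc_of_mem_part (hjk ▸ P.mem_part hk.1) hlt
        exact absurd ⟨i, hi⟩ hj.2
    · have hne := P.nonempty_of_mem_parts hB
      have hm := min'_mem B hne
      refine ⟨B.min' hne, ?_, P.part_eq_of_mem hB hm⟩
      simp only [coe_filter, Set.mem_ofPred_eq]
      refine ⟨P.le hB hm, fun ⟨i, hi⟩ => ?_⟩
      rw [isArc_iff_mem_part, P.part_eq_of_mem hB hm] at hi
      exact hi.1.not_ge (min'_le B i hi.2.1)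
  rw [← hparts, add_comm]
  exact card_filter_add_card_filter_not _

theorem hasKCrossing_two_iff :
    HasKCrossing P 2 ↔
      ∃ i j i' j', IsArc P i j ∧ IsArc P i' j' ∧ i < i' ∧ i' < j ∧ j < j' := by
  constructor
  · rintro ⟨f, g, hf, hg, harc, hfg⟩
    have harc' : ∀ m, IsArc P (f m) (g m) := fun m =>
      (harc m).resolve_right fun h => (hfg m m).ne h.1
    exact ⟨_, _, _, _, harc' 0, harc' 1, hf Fin.zero_lt_one, hfg 1 0, hg Fin.zero_lt_one⟩
  · rintro ⟨i, j, i', j', h, h', h₁, h₂, h₃⟩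
    refine ⟨![i, i'], ![j, j'], ?_, ?_, ?_, ?_⟩
    · intro a b hab; fin_cases a <;> fin_cases b <;> simp_all
    · intro a b hab; fin_cases a <;> fin_cases b <;> simp_all
    · intro m; fin_cases m
      · exact .inl h
      · exact .inl h'
    · have h₄ := h.1
      have h₅ := h'.1
      intro a b; fin_cases a <;> fin_cases b <;> simp <;> omega

end Arcs

section Root

/-- The end of the descending chain `v > p v > p (p v) > ⋯`. -/
def chainRoot (p : ℕ → ℕ) (v : ℕ) : ℕ :=
  if _h : p v < v then chainRoot p (p v) else v
termination_by v

variable {p : ℕ → ℕ} {i j v : ℕ}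

theorem chainRoot_of_lt (h : p v < v) : chainRoot p v = chainRoot p (p v) := by
  rw [chainRoot, dif_pos h]

theorem chainRoot_of_not_lt (h : ¬p v < v) : chainRoot p v = v := by
  rw [chainRoot, dif_neg h]

theorem chainRoot_le (p : ℕ → ℕ) (v : ℕ) : chainRoot p v ≤ v := by
  induction v using Nat.strong_induction_on with
  | _ v ih =>
    by_cases h : p v < v
    · rw [chainRoot_of_lt h]
      exact (ih _ h).trans h.le
    · rw [chainRoot_of_not_lt h]

theorem lt_of_chainRoot_eq (hij : i < j) (h : chainRoot p i = chainRoot p j) : p j < j := by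
  by_contra hj
  rw [chainRoot_of_not_lt hj] at h
  have := chainRoot_le p i
  omega

/-- If `p` is injective where it is decreasing, no element of the chain through `j` lies
strictly between `p j` and `j`. -/
theorem le_of_chainRoot_eq (hp : ∀ a b, p a < a → p b < b → p a = p b → a = b) :
    ∀ i j, i < j → chainRoot p i = chainRoot p j → i ≤ p j := by
  intro i
  induction i using Nat.strong_induction_on with
  | _ i ih =>
    intro j hij h
    by_contra! hlt
    have hj := lt_of_chainRoot_eq hij h
    rw [chainRoot_of_lt hj] at h
    have hi := lt_of_chainRoot_eq hlt h.symm
    have hle := ih _ hlt i hlt h.symm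
    obtain heq | hlt' := hle.eq_or_lt
    · exact hij.ne' (hp _ _ hj hi heq)
    · have := ih _ hi j (hi.trans hij) (by rw [← chainRoot_of_lt hi, h, ← chainRoot_of_lt hj])
      omega

open scoped Classical in
theorem isArc_ofSetSetoid_chainRoot_iff (hp : ∀ a b, p a < a → p b < b → p a = p b → a = b)
    (n : ℕ) :
    IsArc (Finpartition.ofSetSetoid (Setoid.ker (chainRoot p)) (range n)) i j ↔
      p j = i ∧ i < j ∧ j < n := by
  rw [isArc_iff_mem_part]
  simp only [Finpartition.mem_part_ofSetSetoid_iff_rel, mem_range, Setoid.ker_def]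
  constructor
  · rintro ⟨hij, ⟨hj, -, hr⟩, hl⟩
    have hpj := lt_of_chainRoot_eq hij hr.symm
    have h₁ := le_of_chainRoot_eq hp i j hij hr.symm
    have h₂ := hl (p j) ⟨hj, by omega, chainRoot_of_lt hpj⟩
    omega
  · rintro ⟨rfl, hij, hj⟩
    refine ⟨hij, ⟨hj, by omega, chainRoot_of_lt hij⟩, fun l ⟨_, _, hr⟩ ⟨h₁, h₂⟩ => ?_⟩
    exact h₁.not_ge (le_of_chainRoot_eq hp l j h₂ hr.symm)

end Root

/-- `T` is the set of arcs and loops of a noncrossing partial matching of a subset of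
`{1, …, n}`. -/
structure IsMatchingDiagram (n : ℕ) (T : Finset (ℕ × ℕ)) : Prop where
  bound : ∀ x ∈ T, 1 ≤ x.1 ∧ x.1 ≤ x.2 ∧ x.2 ≤ n
  disj : ∀ x ∈ T, ∀ y ∈ T, x.1 = y.1 ∨ x.1 = y.2 ∨ x.2 = y.2 → x = y
  noncrossing : ∀ x ∈ T, ∀ y ∈ T, ¬(x.1 < y.1 ∧ y.1 < x.2 ∧ x.2 < y.2)

section ShiftedArcs

open scoped Classical in
/-- The arcs of `P` with their left endpoints moved one step to the right. -/
noncomputable def shiftedArcs {n : ℕ} (P : Finpartition (range (n + 1))) : Finset (ℕ × ℕ) :=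
  (Icc 1 n ×ˢ Icc 1 n).filter fun x => IsArc P (x.1 - 1) x.2

variable {n : ℕ} {P Q : Finpartition (range (n + 1))}

theorem mem_shiftedArcs {x : ℕ × ℕ} :
    x ∈ shiftedArcs P ↔ 1 ≤ x.1 ∧ IsArc P (x.1 - 1) x.2 := by
  simp only [shiftedArcs, mem_filter, mem_product, mem_Icc]
  refine ⟨fun h => ⟨h.1.1.1, h.2⟩, fun h => ⟨?_, h.2⟩⟩
  have h₁ := mem_range.1 h.2.mem_right
  have h₂ := h.2.1
  omega

theorem succ_mem_shiftedArcs {i j : ℕ} : (i + 1, j) ∈ shiftedArcs P ↔ IsArc P i j := by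
  simp [mem_shiftedArcs]

theorem shiftedArcs_injective :
    Function.Injective (shiftedArcs : Finpartition (range (n + 1)) → Finset (ℕ × ℕ)) :=
  fun P Q h => finpartition_ext_isArc fun i j => by
    rw [← succ_mem_shiftedArcs, h, succ_mem_shiftedArcs]

theorem card_parts_add_card_shiftedArcs (P : Finpartition (range (n + 1))) :
    P.parts.card + (shiftedArcs P).card = n + 1 := by
  classical
  refine Eq.trans ?_ ((card_parts_add_card_filter_isArc P).trans (card_range (n + 1)))
  congr 1
  refine card_nbij Prod.snd (fun x hx => ?_) (fun x hx y hy hxy => ?_) (fun j hj => ?_)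
  · have h := (mem_shiftedArcs.1 hx).2
    exact mem_filter.2 ⟨h.mem_right, _, h⟩
  · have hx := mem_shiftedArcs.1 hx
    have hy := mem_shiftedArcs.1 hy
    rw [hxy] at hx
    have := hx.2.left_unique hy.2
    exact Prod.ext (by omega) hxy
  · obtain ⟨-, i, hi⟩ := mem_filter.1 hj
    exact ⟨(i + 1, j), succ_mem_shiftedArcs.2 hi, rfl⟩

theorem isMatchingDiagram_shiftedArcs (hP : ¬HasKCrossing P 2) :
    IsMatchingDiagram n (shiftedArcs P) := by
  rw [hasKCrossing_two_iff] at hP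
  push Not at hP
  refine ⟨?_, ?_, ?_⟩
  · rintro x hx
    rw [mem_shiftedArcs] at hx
    have h₁ := mem_range.1 hx.2.mem_right
    have h₂ := hx.2.1
    omega
  · rintro ⟨a, c⟩ hx ⟨a', c'⟩ hy h
    rw [mem_shiftedArcs] at hx hy
    obtain ⟨ha, hx⟩ := hx
    obtain ⟨ha', hy⟩ := hy
    dsimp only at *
    have hc := hx.1
    have hc' := hy.1
    rcases h with rfl | rfl | rfl
    · rw [hx.right_unique hy]
    · have hne := hP _ _ _ _ hy hx
      obtain heq | hlt := (show a ≤ c by omega).eq_or_lt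
      · subst heq
        have := hx.left_unique hy
        rw [show a' = a by omega]
      · obtain heq | hlt' := (show a' ≤ a by omega).eq_or_lt
        · subst heq
          rw [hx.right_unique hy]
        · exact absurd (hne (by omega) (by omega)) (by omega)
    · have := hx.left_unique hy
      rw [show a' = a by omega]
  · rintro ⟨a, c⟩ hx ⟨a', c'⟩ hy ⟨h₁, h₂, h₃⟩
    rw [mem_shiftedArcs] at hx hy
    dsimp only at *
    have := hP _ _ _ _ hx.2 hy.2 (by omega) (by omega)
    omega

theorem exists_shiftedArcs_eq {T : Finset (ℕ × ℕ)} (hT : IsMatchingDiagram n T) :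
    ∃ P : Finpartition (range (n + 1)), ¬HasKCrossing P 2 ∧ shiftedArcs P = T := by
  classical
  let p : ℕ → ℕ := fun c => if h : ∃ a, (a, c) ∈ T then h.choose - 1 else c
  have hp_iff : ∀ i j, p j = i ∧ i < j ↔ (i + 1, j) ∈ T := by
    intro i j
    by_cases h : ∃ a, (a, j) ∈ T
    · have hpj : p j = h.choose - 1 := dif_pos h
      have hmem := h.choose_spec
      have hb := hT.bound _ hmem
      dsimp only at hb
      constructor
      · rintro ⟨rfl, -⟩
        rwa [hpj, Nat.sub_add_cancel hb.1]
      · intro hij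
        have := congrArg Prod.fst (hT.disj _ hmem _ hij (by simp))
        dsimp only at this
        omega
    · have hpj : p j = j := dif_neg h
      constructor
      · rintro ⟨rfl, hlt⟩
        omega
      · exact fun hij => absurd ⟨_, hij⟩ h
  have hp : ∀ a b, p a < a → p b < b → p a = p b → a = b := by
    intro a b ha hb hab
    have h₁ := (hp_iff _ a).1 ⟨rfl, ha⟩
    have h₂ := (hp_iff _ b).1 ⟨rfl, hb⟩
    exact congrArg Prod.snd (hT.disj _ h₁ _ h₂ (by simp [hab]))
  let P := Finpartition.ofSetSetoid (Setoid.ker (chainRoot p)) (range (n + 1))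
  have harc : ∀ i j, IsArc P i j ↔ (i + 1, j) ∈ T := by
    intro i j
    rw [isArc_ofSetSetoid_chainRoot_iff hp, ← and_assoc, hp_iff]
    refine and_iff_left_of_imp fun h => ?_
    have := (hT.bound _ h).2.2
    dsimp only at this
    omega
  refine ⟨P, ?_, ?_⟩
  · rw [hasKCrossing_two_iff]
    rintro ⟨i, j, i', j', h, h', h₁, h₂, h₃⟩
    rw [harc] at h h'
    obtain heq | hlt := (show i' + 1 ≤ j by omega).eq_or_lt
    · have := congrArg Prod.fst (hT.disj _ h' _ h (by simp [heq]))
      dsimp only at this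
      omega
    · exact hT.noncrossing _ h _ h' ⟨by dsimp only; omega, hlt, h₃⟩
  · ext ⟨a, c⟩
    rw [mem_shiftedArcs, harc]
    dsimp only
    constructor
    · rintro ⟨ha, h⟩
      rwa [Nat.sub_add_cancel ha] at h
    · intro h
      have ha := (hT.bound _ h).1
      exact ⟨ha, by rwa [Nat.sub_add_cancel ha]⟩

theorem card_noncrossing_eq_card_diagrams (n b : ℕ) :
    Nat.card {P : Finpartition (range (n + 1)) // ¬HasKCrossing P 2 ∧ P.parts.card = b + 1} =
      Nat.card {T // IsMatchingDiagram n T ∧ T.card + b = n} := by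
  refine Nat.card_congr (Equiv.ofBijective (fun P => ⟨shiftedArcs P.1, ?_, ?_⟩) ⟨?_, ?_⟩)
  · exact isMatchingDiagram_shiftedArcs P.2.1
  · have := card_parts_add_card_shiftedArcs P.1
    have := P.2.2
    omega
  · intro P Q h
    exact Subtype.ext (shiftedArcs_injective (congrArg Subtype.val h))
  · rintro ⟨T, hT, hcard⟩
    obtain ⟨P, hP, rfl⟩ := exists_shiftedArcs_eq hT
    have := card_parts_add_card_shiftedArcs P
    exact ⟨⟨P, hP, by omega⟩, rfl⟩

end ShiftedArcs

section SwapLoops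

/-- The elements covered by the arcs and loops in `T`. -/
def diagramSupport (T : Finset (ℕ × ℕ)) : Finset ℕ :=
  T.biUnion fun x => {x.1, x.2}

/-- Turn the loops of `T` into uncovered points, and the uncovered points into loops. -/
def swapLoops (n : ℕ) (T : Finset (ℕ × ℕ)) : Finset (ℕ × ℕ) :=
  (T.filter fun x => x.1 < x.2) ∪ (Icc 1 n \ diagramSupport T).image fun v => (v, v)

variable {n : ℕ} {T : Finset (ℕ × ℕ)}

theorem mem_diagramSupport {v : ℕ} : v ∈ diagramSupport T ↔ ∃ x ∈ T, v = x.1 ∨ v = x.2 := by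
  simp [diagramSupport]

theorem mem_swapLoops {a c : ℕ} :
    (a, c) ∈ swapLoops n T ↔
      (a, c) ∈ T ∧ a < c ∨ a = c ∧ (1 ≤ a ∧ a ≤ n) ∧ a ∉ diagramSupport T := by
  simp only [swapLoops, mem_union, mem_filter, mem_image, mem_sdiff, mem_Icc, Prod.mk.injEq]
  grind

theorem IsMatchingDiagram.swapLoops (hT : IsMatchingDiagram n T) :
    IsMatchingDiagram n (swapLoops n T) := by
  refine ⟨?_, ?_, ?_⟩
  · rintro ⟨a, c⟩ hx
    rcases mem_swapLoops.1 hx with ⟨h, -⟩ | ⟨rfl, h, -⟩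
    · exact hT.bound _ h
    · exact ⟨h.1, le_rfl, h.2⟩
  · rintro ⟨a, c⟩ hx ⟨a', c'⟩ hy h
    rw [mem_swapLoops] at hx hy
    simp only [mem_diagramSupport] at hx hy
    rcases hx with hx | hx <;> rcases hy with hy | hy
    · exact hT.disj _ hx.1 _ hy.1 h
    · exact absurd ⟨_, hx.1, by dsimp only at *; omega⟩ hy.2.2
    · exact absurd ⟨_, hy.1, by dsimp only at *; omega⟩ hx.2.2
    · dsimp only at h
      ext <;> dsimp only <;> omega
  · rintro ⟨a, c⟩ hx ⟨a', c'⟩ hy h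
    rw [mem_swapLoops] at hx hy
    have hx' : (a, c) ∈ T := by dsimp only at *; grind
    have hy' : (a', c') ∈ T := by dsimp only at *; grind
    exact hT.noncrossing _ hx' _ hy' h

theorem IsMatchingDiagram.loop_mem_iff (hT : IsMatchingDiagram n T) {v : ℕ} :
    (v, v) ∈ T ↔ v ∈ diagramSupport T ∧ ∀ x ∈ T, x.1 < x.2 → v ≠ x.1 ∧ v ≠ x.2 := by
  constructor
  · intro h
    refine ⟨mem_diagramSupport.2 ⟨_, h, .inl rfl⟩, fun x hx hlt => ?_⟩
    by_contra hne
    have := hT.disj _ h x hx (by dsimp only; omega)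
    subst this
    exact lt_irrefl _ hlt
  · rintro ⟨h, hne⟩
    obtain ⟨⟨a, c⟩, hx, hv⟩ := mem_diagramSupport.1 h
    have hb := (hT.bound _ hx).2.1
    have := hne _ hx
    dsimp only at *
    obtain ⟨rfl, rfl⟩ : a = v ∧ c = v := by omega
    exact hx

theorem IsMatchingDiagram.swapLoops_swapLoops (hT : IsMatchingDiagram n T) :
    _root_.swapLoops n (_root_.swapLoops n T) = T := by
  have hsupp : ∀ v, 1 ≤ v → v ≤ n →
      (v ∉ diagramSupport (_root_.swapLoops n T) ↔ (v, v) ∈ T) := by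
    intro v h₁ h₂
    rw [hT.loop_mem_iff, mem_diagramSupport (T := _root_.swapLoops n T)]
    constructor
    · intro h
      refine ⟨?_, fun x hx hlt => ?_⟩
      · by_contra hv
        exact h ⟨(v, v), mem_swapLoops.2 (.inr ⟨rfl, ⟨h₁, h₂⟩, hv⟩), .inl rfl⟩
      · by_contra hv
        exact h ⟨x, mem_swapLoops.2 (.inl ⟨hx, hlt⟩), by omega⟩
    · rintro ⟨hv, hne⟩ ⟨⟨a, c⟩, hx, h⟩
      rcases mem_swapLoops.1 hx with ⟨hx, hlt⟩ | ⟨rfl, -, ha⟩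
      · have := hne _ hx hlt
        omega
      · obtain rfl : v = a := by simpa using h
        exact ha hv
  ext ⟨a, c⟩
  rw [mem_swapLoops, mem_swapLoops]
  have hb : (a, c) ∈ T → 1 ≤ a ∧ a ≤ c ∧ c ≤ n := hT.bound (a, c)
  grind

theorem IsMatchingDiagram.diagramSupport_subset (hT : IsMatchingDiagram n T) :
    diagramSupport T ⊆ Icc 1 n := by
  intro v hv
  obtain ⟨x, hx, h⟩ := mem_diagramSupport.1 hv
  have := hT.bound x hx
  rw [mem_Icc]
  omega

theorem IsMatchingDiagram.card_diagramSupport (hT : IsMatchingDiagram n T) :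
    (diagramSupport T).card = T.card + (T.filter fun x => x.1 < x.2).card := by
  rw [diagramSupport, card_biUnion, card_filter, card_eq_sum_ones, ← sum_add_distrib]
  · refine sum_congr rfl fun x hx => ?_
    have := (hT.bound x hx).2.1
    split_ifs with h
    · rw [card_pair h.ne]
    · simp [show x.1 = x.2 by omega]
  · intro x hx y hy hxy
    rw [Function.onFun, disjoint_left]
    intro v hv hv'
    simp only [mem_insert, mem_singleton] at hv hv'
    have h₁ := hT.disj x hx y hy
    have h₂ := hT.disj y hy x hx
    grind

theorem IsMatchingDiagram.card_add_card_swapLoops (hT : IsMatchingDiagram n T) :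
    T.card + (_root_.swapLoops n T).card = n := by
  have hdisj : Disjoint (T.filter fun x => x.1 < x.2)
      ((Icc 1 n \ diagramSupport T).image fun v => (v, v)) := by
    rw [disjoint_left]
    rintro ⟨a, c⟩ h h'
    simp only [mem_filter, mem_image, Prod.mk.injEq] at h h'
    obtain ⟨v, -, rfl, rfl⟩ := h'
    exact lt_irrefl _ h.2
  have hcard := card_sdiff_add_card_eq_card hT.diagramSupport_subset
  rw [Nat.card_Icc, hT.card_diagramSupport] at hcard
  rw [_root_.swapLoops, card_union_of_disjoint hdisj,
    card_image_of_injective _ fun v w h => congrArg Prod.fst h]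
  omega

theorem card_diagrams_symm (n b : ℕ) :
    Nat.card {T // IsMatchingDiagram n T ∧ T.card + b = n} =
      Nat.card {T // IsMatchingDiagram n T ∧ T.card = b} := by
  refine Nat.card_congr
    { toFun := fun T => ⟨swapLoops n T.1, T.2.1.swapLoops, ?_⟩
      invFun := fun T => ⟨swapLoops n T.1, T.2.1.swapLoops, ?_⟩
      left_inv := fun T => Subtype.ext T.2.1.swapLoops_swapLoops
      right_inv := fun T => Subtype.ext T.2.1.swapLoops_swapLoops }
  all_goals
    have h₁ := T.2.1.card_add_card_swapLoops
    have h₂ := T.2.2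
    omega

end SwapLoops

section MatchingDiagram

/-- The arcs and loops of a partial matching. -/
def matchingDiagram {s : Finset ℕ} (P : Finpartition s) : Finset (ℕ × ℕ) :=
  (s ×ˢ s).filter fun x => x.1 ≤ x.2 ∧ {x.1, x.2} ∈ P.parts

variable {s : Finset ℕ} {P : Finpartition s} {n : ℕ}

theorem mem_matchingDiagram {x : ℕ × ℕ} :
    x ∈ matchingDiagram P ↔ x.1 ≤ x.2 ∧ {x.1, x.2} ∈ P.parts := by
  simp only [matchingDiagram, mem_filter, mem_product, and_iff_right_iff_imp]
  exact fun h => ⟨P.le h.2 (by simp), P.le h.2 (by simp)⟩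

theorem eq_of_pair_eq_of_le {x y : ℕ × ℕ} (hx : x.1 ≤ x.2) (hy : y.1 ≤ y.2)
    (h : ({x.1, x.2} : Finset ℕ) = {y.1, y.2}) : x = y := by
  have h₁ : x.1 ∈ ({y.1, y.2} : Finset ℕ) := h ▸ (by simp)
  have h₂ : x.2 ∈ ({y.1, y.2} : Finset ℕ) := h ▸ (by simp)
  have h₃ : y.1 ∈ ({x.1, x.2} : Finset ℕ) := h ▸ (by simp)
  have h₄ : y.2 ∈ ({x.1, x.2} : Finset ℕ) := h ▸ (by simp)
  simp only [mem_insert, mem_singleton] at h₁ h₂ h₃ h₄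
  ext <;> omega

theorem image_matchingDiagram (hP : IsPartialMatching P) :
    ((matchingDiagram P).image fun x => ({x.1, x.2} : Finset ℕ)) = P.parts := by
  ext B
  simp only [mem_image, mem_matchingDiagram]
  constructor
  · rintro ⟨x, hx, rfl⟩
    exact hx.2
  · intro hB
    rcases hP B hB with h | h
    · obtain ⟨a, rfl⟩ := card_eq_one.1 h
      exact ⟨(a, a), by simpa using hB, by simp⟩
    · obtain ⟨a, c, hac, rfl⟩ := card_eq_two.1 h
      rcases hac.lt_or_gt with hlt | hlt
      · exact ⟨(a, c), ⟨hlt.le, hB⟩, rfl⟩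
      · exact ⟨(c, a), ⟨hlt.le, by rwa [pair_comm]⟩, pair_comm _ _⟩

theorem card_matchingDiagram (hP : IsPartialMatching P) :
    (matchingDiagram P).card = P.parts.card := by
  rw [← image_matchingDiagram hP, card_image_of_injOn]
  intro x hx y hy h
  exact eq_of_pair_eq_of_le (mem_matchingDiagram.1 hx).1 (mem_matchingDiagram.1 hy).1 h

theorem IsPartialMatching.isArc_iff (hP : IsPartialMatching P) {i j : ℕ} :
    IsArc P i j ↔ i < j ∧ {i, j} ∈ P.parts := by
  refine and_congr_right fun hij => ⟨?_, fun h => ⟨_, h, by simp, by simp, ?_⟩⟩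
  · rintro ⟨B, hB, hi, hj, -⟩
    have hsub : {i, j} ⊆ B := by simp [insert_subset_iff, hi, hj]
    have hcard : B.card ≤ ({i, j} : Finset ℕ).card := by
      rw [card_pair hij.ne]
      rcases hP B hB with h | h <;> omega
    rwa [eq_of_subset_of_card_le hsub hcard]
  · simp

theorem isMatchingDiagram_matchingDiagram (hs : s ⊆ Icc 1 n) (hP : IsPartialMatching P)
    (hnc : ¬HasKCrossing P 2) : IsMatchingDiagram n (matchingDiagram P) := by
  refine ⟨?_, ?_, ?_⟩
  · intro x hx
    rw [mem_matchingDiagram] at hx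
    have h₁ := mem_Icc.1 (hs (P.le hx.2 (show x.1 ∈ _ by simp)))
    have h₂ := mem_Icc.1 (hs (P.le hx.2 (show x.2 ∈ _ by simp)))
    omega
  · intro x hx y hy h
    rw [mem_matchingDiagram] at hx hy
    refine eq_of_pair_eq_of_le hx.1 hy.1 ?_
    rcases h with h | h | h
    · exact P.eq_of_mem_parts hx.2 hy.2 (a := x.1) (by simp) (by simp [h])
    · exact P.eq_of_mem_parts hx.2 hy.2 (a := x.1) (by simp) (by simp [h])
    · exact P.eq_of_mem_parts hx.2 hy.2 (a := x.2) (by simp) (by simp [h])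
  · rintro x hx y hy ⟨h₁, h₂, h₃⟩
    rw [mem_matchingDiagram] at hx hy
    refine hnc (hasKCrossing_two_iff.2 ⟨_, _, _, _, ?_, ?_, h₁, h₂, h₃⟩)
    · exact hP.isArc_iff.2 ⟨h₁.trans h₂, hx.2⟩
    · exact hP.isArc_iff.2 ⟨h₂.trans h₃, hy.2⟩

theorem diagramSupport_matchingDiagram (hP : IsPartialMatching P) :
    diagramSupport (matchingDiagram P) = s := by
  refine Eq.trans ?_ P.biUnion_parts
  rw [← image_matchingDiagram hP, image_biUnion]
  rfl

theorem IsMatchingDiagram.exists_matchingDiagram_eq {T : Finset (ℕ × ℕ)}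
    (hT : IsMatchingDiagram n T) :
    diagramSupport T ⊆ Icc 1 n ∧ ∃ P : Finpartition (diagramSupport T),
      ¬HasKCrossing P 2 ∧ IsPartialMatching P ∧ matchingDiagram P = T := by
  refine ⟨hT.diagramSupport_subset, ?_⟩
  let P : Finpartition (diagramSupport T) :=
    { parts := T.image fun x => {x.1, x.2}
      supIndep := by
        rw [supIndep_iff_pairwiseDisjoint]
        intro B hB C hC hBC
        simp only [coe_image, Set.mem_image, mem_coe] at hB hC
        obtain ⟨x, hx, rfl⟩ := hB
        obtain ⟨y, hy, rfl⟩ := hC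
        have h₁ := hT.disj x hx y hy
        have h₂ := hT.disj y hy x hx
        rw [Function.onFun, id, id, disjoint_left]
        intro v hv hv'
        simp only [mem_insert, mem_singleton] at hv hv'
        grind
      sup_parts := by
        rw [sup_image, diagramSupport, sup_eq_biUnion]
        rfl
      bot_notMem := by
        simp }
  have hmem : ∀ B, B ∈ P.parts ↔ ∃ x ∈ T, {x.1, x.2} = B := fun B => mem_image
  have hP : IsPartialMatching P := by
    intro B hB
    obtain ⟨x, -, rfl⟩ := (hmem B).1 hB
    by_cases h : x.1 = x.2
    · simp [h]
    · exact .inr (card_pair h)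
  have hdiag : matchingDiagram P = T := by
    ext x
    rw [mem_matchingDiagram, hmem]
    constructor
    · rintro ⟨hx, y, hy, h⟩
      rwa [← eq_of_pair_eq_of_le (hT.bound y hy).2.1 hx h]
    · exact fun hx => ⟨(hT.bound x hx).2.1, x, hx, rfl⟩
  refine ⟨P, ?_, hP, hdiag⟩
  rw [hasKCrossing_two_iff]
  rintro ⟨i, j, i', j', h, h', hlt⟩
  rw [hP.isArc_iff] at h h'
  have hij : (i, j) ∈ T := hdiag ▸ mem_matchingDiagram.2 ⟨h.1.le, h.2⟩
  have hij' : (i', j') ∈ T := hdiag ▸ mem_matchingDiagram.2 ⟨h'.1.le, h'.2⟩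
  exact hT.noncrossing _ hij _ hij' hlt

theorem card_matchings_eq_card_diagrams (n b : ℕ) :
    Nat.card {p : Σ A : Finset ℕ, Finpartition A //
        p.1 ⊆ Icc 1 n ∧ ¬HasKCrossing p.2 2 ∧ IsPartialMatching p.2 ∧ p.2.parts.card = b} =
      Nat.card {T // IsMatchingDiagram n T ∧ T.card = b} := by
  refine Nat.card_congr (Equiv.ofBijective (fun p => ⟨matchingDiagram p.1.2, ?_, ?_⟩) ⟨?_, ?_⟩)
  · exact isMatchingDiagram_matchingDiagram p.2.1 p.2.2.2.1 p.2.2.1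
  · rw [card_matchingDiagram p.2.2.2.1, p.2.2.2.2]
  · rintro ⟨⟨A, P⟩, _, _, hP, _⟩ ⟨⟨B, Q⟩, _, _, hQ, _⟩ h
    have h : matchingDiagram P = matchingDiagram Q := congrArg Subtype.val h
    obtain rfl : A = B :=
      (diagramSupport_matchingDiagram hP).symm.trans (h ▸ diagramSupport_matchingDiagram hQ)
    obtain rfl : P = Q := by
      ext1
      rw [← image_matchingDiagram hP, h, image_matchingDiagram hQ]
    rfl
  · rintro ⟨T, hT, hcard⟩
    obtain ⟨hsub, P, hnc, hP, hdiag⟩ := hT.exists_matchingDiagram_eq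
    refine ⟨⟨⟨_, P⟩, hsub, hnc, hP, ?_⟩, Subtype.ext hdiag⟩
    rw [← card_matchingDiagram hP, hdiag, hcard]

end MatchingDiagram

/-- For all `n, b ≥ 0`, the number of noncrossing partitions of
`{0,1,…,n}` with exactly `b+1` blocks equals the number of pairs `(A, μ)` where
`A ⊆ {1,…,n}` and `μ` is a noncrossing partial matching of `A` with exactly `b` blocks
(for `A = ∅`, `μ` is the empty matching with `0` blocks). -/
theorem stmt19 (n b : ℕ) :
    Nat.card {P : Finpartition (Finset.range (n + 1)) //
        ¬ HasKCrossing P 2 ∧ P.parts.card = b + 1} =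
      Nat.card {p : Σ A : Finset ℕ, Finpartition A //
        p.1 ⊆ Finset.Icc 1 n ∧ ¬ HasKCrossing p.2 2 ∧ IsPartialMatching p.2 ∧
        p.2.parts.card = b} := by
  rw [card_noncrossing_eq_card_diagrams, card_diagrams_symm, card_matchings_eq_card_diagrams]
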